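/- Let F = (p,q) : ℝ² → ℝ² be Pinchuk's map and let C = Φ(ℝ) ⊆ ℝ² where Φ(s) = (s² + 2s, u(s² + s, s)). Then for every point v ∈ ℝ² \ C, the fiber F⁻¹(v) has exactly 2 elements. -/

import Mathlib

noncomputable section

/-- The Pinchuk auxiliary polynomial `t = xy - 1`. -/
def pT (x y : ℝ) : ℝ := x * y - 1

/-- The Pinchuk auxiliary polynomial `h = t(xt + 1)`. -/
def pH (x y : ℝ) : ℝ := pT x y * (x * pT x y + 1)

/-- The Pinchuk auxiliary polynomial `f = (xt+1)^2 (t^2 + y)`. -/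
def pF (x y : ℝ) : ℝ := (x * pT x y + 1) ^ 2 * ((pT x y) ^ 2 + y)

/-- The Pinchuk polynomial `u(f,h)`. -/
def pU (f h : ℝ) : ℝ :=
  (1/4) * f * (75*f^3 + 300*f^2*h + 450*f*h^2 + 276*f^2 + 828*f*h + 48*h^2 + 364*f + 48*h)

/-- Pinchuk's map `F = (p, q) : ℝ² → ℝ²` with `p = f + h` and
    `q = -t² - 6th(h+1) + u(f,h)`. -/
def pinchuk : ℝ × ℝ → ℝ × ℝ := fun v =>
  (pF v.1 v.2 + pH v.1 v.2,
   -(pT v.1 v.2)^2 - 6 * pT v.1 v.2 * pH v.1 v.2 * (pH v.1 v.2 + 1)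
     + pU (pF v.1 v.2) (pH v.1 v.2))

/-- The parameterization `Φ(s) = (s² + 2s, u(s² + s, s))`. -/
def Phi (s : ℝ) : ℝ × ℝ := (s^2 + 2*s, pU (s^2 + s) s)

/-- A continuous map `g : X → Y` is *not proper at* `y ∈ Y` if there is no
    neighborhood `U` of `y` such that `g ⁻¹(cl U)` is compact. -/
def NotProperAt {X Y : Type*} [TopologicalSpace X] [TopologicalSpace Y]
    (g : X → Y) (y : Y) : Prop :=
  ¬ ∃ U ∈ nhds y, IsCompact (g ⁻¹' closure U)

/-- The value of `t` at the point of the level curve `p = f + h` with prescribed `h ≠ p`. -/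
def levelT (p h : ℝ) : ℝ := h * (p - 2 * h - h ^ 2) / (p - h)

/-- The value of `q` at the point of the level curve `p = f + h` with prescribed `h ≠ p`. -/
def levelQ (p h : ℝ) : ℝ :=
  -(levelT p h) ^ 2 - 6 * levelT p h * h * (h + 1) + pU (p - h) h

/-- The point of the level curve `p = f + h` with prescribed `h ≠ p`. -/
def levelPoint (p h : ℝ) : ℝ × ℝ :=
  ((p - h) * (h + 1) / (p - 2 * h - h ^ 2) ^ 2,
    (p - 2 * h - h ^ 2) ^ 2 * (p - h - h ^ 2) / (p - h) ^ 2)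

/-- The polynomial `(p - h)² (levelQ p h - v)` in `h`, with its denominators cleared. -/
def levelNumerator (p v h : ℝ) : ℝ :=
  -(h * (p - 2 * h - h ^ 2)) ^ 2 - 6 * (h * (p - 2 * h - h ^ 2)) * (p - h) * h * (h + 1)
    + (p - h) ^ 2 * (pU (p - h) h - v)

lemma pF_mul_pH_sub_pT (x y : ℝ) :
    pF x y * (pH x y - pT x y) = pH x y ^ 2 * (pH x y + 1) := by
  simp only [pF, pH, pT]; ring

lemma mul_pF_sub_sq (x y : ℝ) :
    x * (pF x y - pH x y - pH x y ^ 2) ^ 2 = pF x y * (pH x y + 1) := by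
  simp only [pF, pH, pT]; ring

lemma mul_pF_sq (x y : ℝ) :
    y * pF x y ^ 2 = (pF x y - pH x y - pH x y ^ 2) ^ 2 * (pF x y - pH x y ^ 2) := by
  simp only [pF, pH, pT]; ring

lemma pT_eq_levelT {x y : ℝ} (hf : pF x y ≠ 0) :
    pT x y = levelT (pF x y + pH x y) (pH x y) := by
  rw [levelT, add_sub_cancel_right, eq_div_iff hf]
  linear_combination -pF_mul_pH_sub_pT x y

lemma pinchuk_snd_eq_levelQ {x y : ℝ} (hf : pF x y ≠ 0) :
    (pinchuk (x, y)).2 = levelQ (pF x y + pH x y) (pH x y) := by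
  simp only [pinchuk, levelQ, ← pT_eq_levelT hf, add_sub_cancel_right]

lemma eq_levelPoint {x y : ℝ} (hf : pF x y ≠ 0) :
    (x, y) = levelPoint (pF x y + pH x y) (pH x y) := by
  have hne : pF x y - pH x y - pH x y ^ 2 ≠ 0 := by
    intro h0
    have ht : pT x y * pF x y = 0 := by
      linear_combination -pF_mul_pH_sub_pT x y + pH x y * h0
    have ht0 : pT x y = 0 := (mul_eq_zero.mp ht).resolve_right hf
    have hh : pH x y = 0 := by rw [pH, ht0, zero_mul]
    rw [hh] at h0
    exact hf (by linear_combination h0)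
  have e : pF x y + pH x y - 2 * pH x y - pH x y ^ 2 = pF x y - pH x y - pH x y ^ 2 := by ring
  rw [levelPoint, e, add_sub_cancel_right, Prod.mk.injEq]
  exact ⟨by rw [eq_div_iff (pow_ne_zero 2 hne), mul_pF_sub_sq],
    by rw [eq_div_iff (pow_ne_zero 2 hf), mul_pF_sq]⟩

lemma pT_levelPoint {p h : ℝ} (hp : p - h ≠ 0) (hs : p - 2 * h - h ^ 2 ≠ 0) :
    pT (levelPoint p h).1 (levelPoint p h).2 = levelT p h := by
  simp only [pT, levelPoint, levelT]
  have hs' : p - h * 2 - h ^ 2 ≠ 0 := by rwa [mul_comm h 2]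
  field_simp
  ring

lemma mul_levelT_add_one {p h : ℝ} (hp : p - h ≠ 0) (hs : p - 2 * h - h ^ 2 ≠ 0) :
    (levelPoint p h).1 * levelT p h + 1 = (p - h) / (p - 2 * h - h ^ 2) := by
  simp only [levelPoint, levelT]
  have hs' : p - h * 2 - h ^ 2 ≠ 0 := by rwa [mul_comm h 2]
  field_simp
  ring

lemma pH_levelPoint {p h : ℝ} (hp : p - h ≠ 0) (hs : p - 2 * h - h ^ 2 ≠ 0) :
    pH (levelPoint p h).1 (levelPoint p h).2 = h := by
  rw [pH, pT_levelPoint hp hs, mul_levelT_add_one hp hs, levelT]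
  have hs' : p - h * 2 - h ^ 2 ≠ 0 := by rwa [mul_comm h 2]
  field_simp

lemma pF_levelPoint {p h : ℝ} (hp : p - h ≠ 0) (hs : p - 2 * h - h ^ 2 ≠ 0) :
    pF (levelPoint p h).1 (levelPoint p h).2 = p - h := by
  rw [pF, pT_levelPoint hp hs, mul_levelT_add_one hp hs, levelT, levelPoint]
  have hs' : p - h * 2 - h ^ 2 ≠ 0 := by rwa [mul_comm h 2]
  field_simp
  ring

lemma pinchuk_levelPoint {p h : ℝ} (hp : p - h ≠ 0) (hs : p - 2 * h - h ^ 2 ≠ 0) :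
    pinchuk (levelPoint p h) = (p, levelQ p h) := by
  simp only [pinchuk, pT_levelPoint hp hs, pH_levelPoint hp hs, pF_levelPoint hp hs, levelQ,
    sub_add_cancel]

lemma levelNumerator_eq {p v h : ℝ} (hp : p - h ≠ 0) :
    levelNumerator p v h = (p - h) ^ 2 * (levelQ p h - v) := by
  simp only [levelNumerator, levelQ, levelT]
  field_simp
  ring

lemma hasDerivAt_levelQ {p h : ℝ} (hp : p - h ≠ 0) :
    HasDerivAt (levelQ p)
      ((levelT p h ^ 2 + (levelT p h + (p - h) * (13 + 15 * h)) ^ 2 + (p - h) ^ 2) / (h - p)) h := by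
  have hi := hasDerivAt_id' h
  have hf : HasDerivAt (fun z => p - z) (-1) h := hi.const_sub p
  have ht : HasDerivAt (levelT p) _ h :=
    (hi.mul (((hasDerivAt_const h p).sub (hi.const_mul 2)).sub (hi.pow 2))).div hf hp
  have hU : HasDerivAt (fun z => pU (p - z) z) _ h :=
    ((hf.const_mul (1 / 4)).mul
      (((((((hf.pow 3).const_mul 75).add (((hf.pow 2).const_mul 300).mul hi)).add
        ((hf.const_mul 450).mul (hi.pow 2))).add ((hf.pow 2).const_mul 276)).add
        ((hf.const_mul 828).mul hi)).add ((hi.pow 2).const_mul 48) |>.add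
        (hf.const_mul 364) |>.add (hi.const_mul 48)))
  have hQ : HasDerivAt (levelQ p) _ h :=
    ((ht.pow 2).neg.sub ((((ht.const_mul 6).mul hi)).mul (hi.add_const 1))).add hU
  convert hQ using 1
  obtain ⟨d, rfl⟩ : ∃ d, p = h + d := ⟨p - h, by ring⟩
  have hd : h - (h + d) = -d := by ring
  rw [add_sub_cancel_left] at hp
  simp only [levelT, Pi.mul_apply, Pi.sub_apply, Pi.pow_apply, add_sub_cancel_left, hd]
  push_cast
  field_simp
  ring

lemma strictMonoOn_levelQ (p : ℝ) : StrictMonoOn (levelQ p) (Set.Ioi p) := by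
  refine strictMonoOn_of_deriv_pos (convex_Ioi p) (fun h hh => ?_) (fun h hh => ?_)
  · exact (hasDerivAt_levelQ (sub_ne_zero.mpr (ne_of_lt hh))).continuousAt.continuousWithinAt
  · rw [interior_Ioi] at hh
    have hp : p - h ≠ 0 := sub_ne_zero.mpr (ne_of_lt hh)
    rw [(hasDerivAt_levelQ hp).deriv]
    exact div_pos (by positivity) (sub_pos.mpr hh)

lemma strictAntiOn_levelQ (p : ℝ) : StrictAntiOn (levelQ p) (Set.Iio p) := by
  refine strictAntiOn_of_deriv_neg (convex_Iio p) (fun h hh => ?_) (fun h hh => ?_)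
  · exact (hasDerivAt_levelQ (sub_ne_zero.mpr (ne_of_gt hh))).continuousAt.continuousWithinAt
  · rw [interior_Iio] at hh
    have hp : p - h ≠ 0 := sub_ne_zero.mpr (ne_of_gt hh)
    rw [(hasDerivAt_levelQ hp).deriv]
    exact div_neg_of_pos_of_neg (by positivity) (sub_neg.mpr hh)

lemma exists_levelNumerator_pos (p v : ℝ) :
    (∃ h, p < h ∧ 0 < levelNumerator p v h) ∧ ∃ h, h < p ∧ 0 < levelNumerator p v h := by
  let M : ℝ → ℝ := fun w =>
    -(p * w ^ 2 - 2 * w - 1) ^ 2 - 6 * (p * w ^ 2 - 2 * w - 1) * (p * w - 1) * (1 + w)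
      + (p * w - 1) ^ 2 * ((1/4) * (p * w - 1) * (75 * (p * w - 1) ^ 3 + 300 * (p * w - 1) ^ 2
        + 450 * (p * w - 1) + 276 * (p * w - 1) ^ 2 * w + 828 * (p * w - 1) * w + 48 * w
        + 364 * (p * w - 1) * w ^ 2 + 48 * w ^ 2) - v * w ^ 4)
  have hM : ∀ w, w ≠ 0 → levelNumerator p v w⁻¹ = M w / w ^ 6 := by
    intro w hw
    simp only [levelNumerator, pU, M]
    field_simp
  have hev : ∀ᶠ w in nhds (0 : ℝ), 0 < M w ∧ p * w < 1 := by
    refine Filter.Eventually.and ?_ ?_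
    · exact continuousAt_const.eventually_lt (by fun_prop : ContinuousAt M 0) (by norm_num [M])
    · exact ContinuousAt.eventually_lt (by fun_prop) continuousAt_const (by norm_num)
  obtain ⟨ε, hε, hball⟩ := Metric.eventually_nhds_iff.mp hev
  have hpos : ∀ w, w ≠ 0 → |w| < ε → 0 < levelNumerator p v w⁻¹ ∧ p * w < 1 := by
    intro w hw hwε
    obtain ⟨h1, h2⟩ := hball (by simpa using hwε : dist w 0 < ε)
    rw [hM w hw]
    exact ⟨by positivity, h2⟩
  have habs : |ε / 2| < ε := by rw [abs_of_pos (by positivity)]; linarith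
  constructor
  · obtain ⟨h1, h2⟩ := hpos (ε / 2) (by positivity) habs
    exact ⟨_, by rwa [← one_div, lt_div_iff₀ (by positivity)], h1⟩
  · obtain ⟨h1, h2⟩ := hpos (-(ε / 2)) (by simpa using hε.ne') (by rwa [abs_neg])
    exact ⟨_, by rwa [← one_div, div_lt_iff_of_neg (by linarith)], h1⟩

lemma exists_levelQ_eq_of_factor {p v : ℝ} {R d : ℝ → ℝ} (hR : Continuous R) (hRp : R p < 0)
    (hd : ∀ h, 0 ≤ d h) (hN : ∀ h, levelNumerator p v h = d h * R h) :
    (∃ h, p < h ∧ levelQ p h = v) ∧ ∃ h, h < p ∧ levelQ p h = v := by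
  have hroot : ∀ h, h ≠ p → R h = 0 → levelQ p h = v := by
    intro h hh h0
    have hp : p - h ≠ 0 := sub_ne_zero.mpr hh.symm
    have := levelNumerator_eq (v := v) hp
    rw [hN, h0, mul_zero, eq_comm, mul_eq_zero] at this
    exact sub_eq_zero.mp (this.resolve_left (pow_ne_zero 2 hp))
  obtain ⟨⟨a, ha, hNa⟩, b, hb, hNb⟩ := exists_levelNumerator_pos p v
  rw [hN] at hNa hNb
  constructor
  · obtain ⟨h, hh, h0⟩ := intermediate_value_Ioo ha.le hR.continuousOn
      ⟨hRp, pos_of_mul_pos_right hNa (hd a)⟩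
    exact ⟨h, hh.1, hroot h hh.1.ne' h0⟩
  · obtain ⟨h, hh, h0⟩ := intermediate_value_Ioo' hb.le hR.continuousOn
      ⟨hRp, pos_of_mul_pos_right hNb (hd b)⟩
    exact ⟨h, hh.2, hroot h hh.2.ne h0⟩

lemma levelNumerator_zero (v h : ℝ) : levelNumerator 0 v h =
    h ^ 2 * (h ^ 2 * (197 / 4 * h ^ 2 + 104 * h + 63) - v) := by
  simp only [levelNumerator, pU]; ring

lemma levelNumerator_neg_one (v h : ℝ) : levelNumerator (-1) v h =
    (h + 1) ^ 2 * ((h + 1) ^ 2 * (197 / 4 * h ^ 2 + 177 / 2 * h + 163 / 4) - v) := by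
  simp only [levelNumerator, pU]; ring

lemma exists_levelQ_eq {p v : ℝ} (hpv : (p ≠ 0 ∧ p ≠ -1) ∨ 0 < v) :
    (∃ h, p < h ∧ levelQ p h = v) ∧ ∃ h, h < p ∧ levelQ p h = v := by
  by_cases h0 : p = 0
  · subst h0
    have hv : 0 < v := hpv.resolve_left (by simp)
    exact exists_levelQ_eq_of_factor (by fun_prop) (by simpa using hv) (fun h => sq_nonneg h)
      (levelNumerator_zero v)
  by_cases h1 : p = -1
  · subst h1
    have hv : 0 < v := hpv.resolve_left (by simp)
    exact exists_levelQ_eq_of_factor (by fun_prop) (by simpa using hv)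
      (fun h => sq_nonneg (h + 1)) (levelNumerator_neg_one v)
  · refine exists_levelQ_eq_of_factor (R := levelNumerator p v) (d := fun _ => 1)
      (by unfold levelNumerator pU; fun_prop) ?_ (fun _ => zero_le_one) (fun h => (one_mul _).symm)
    have hp : 0 < p ^ 4 * (p + 1) ^ 2 := by
      have : p + 1 ≠ 0 := fun h => h1 (by linear_combination h)
      positivity
    have : levelNumerator p v p = -(p ^ 4 * (p + 1) ^ 2) := by
      simp only [levelNumerator]; ring
    linarith

lemma levelQ_pos {p h : ℝ} (hp : p = 0 ∨ p = -1) (hh : p - h ≠ 0) : 0 < levelQ p h := by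
  have hsq : 0 < (p - h) ^ 2 := by positivity
  obtain ⟨c, hc, hN⟩ : ∃ c, 0 < c ∧ levelNumerator p 0 h = (p - h) ^ 2 * ((p - h) ^ 2 * c) := by
    rcases hp with rfl | rfl
    · exact ⟨197 / 4 * h ^ 2 + 104 * h + 63, by nlinarith [sq_nonneg (h + 208 / 197)],
        by rw [levelNumerator_zero]; ring⟩
    · exact ⟨197 / 4 * h ^ 2 + 177 / 2 * h + 163 / 4, by nlinarith [sq_nonneg (h + 177 / 197)],
        by rw [levelNumerator_neg_one]; ring⟩
  rw [levelNumerator_eq hh, sub_zero] at hN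
  rw [mul_left_cancel₀ hsq.ne' hN]
  positivity

lemma pH_eq_zero_or_neg_one {x y : ℝ} (hf : pF x y = 0) : pH x y = 0 ∨ pH x y = -1 := by
  have h := pF_mul_pH_sub_pT x y
  rw [hf, zero_mul, eq_comm, mul_eq_zero] at h
  exact h.imp (fun h => pow_eq_zero_iff two_ne_zero |>.mp h) eq_neg_of_add_eq_zero_left

lemma pinchuk_snd_of_pF_eq_zero {x y : ℝ} (hf : pF x y = 0) :
    (pinchuk (x, y)).2 = -pT x y ^ 2 := by
  rcases pH_eq_zero_or_neg_one hf with h | h <;> simp [pinchuk, hf, h, pU]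

lemma pinchuk_fiber_generic {p v : ℝ} (hC : (p, v) ∉ Set.range Phi)
    (hpv : (p ≠ 0 ∧ p ≠ -1) ∨ 0 < v) :
    ∃ a b : ℝ × ℝ, a ≠ b ∧ pinchuk ⁻¹' {(p, v)} = {a, b} := by
  obtain ⟨⟨h₁, hlt₁, hQ₁⟩, h₂, hlt₂, hQ₂⟩ := exists_levelQ_eq hpv
  have hs : ∀ h, levelQ p h = v → p - 2 * h - h ^ 2 ≠ 0 := by
    intro h hQ h0
    refine hC ⟨h, ?_⟩
    have e : p - h = h ^ 2 + h := by linear_combination h0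
    rw [levelQ, levelT, h0, e] at hQ
    rw [Phi, ← hQ, Prod.mk.injEq]
    exact ⟨by linear_combination -h0, by ring⟩
  have hp₁ : p - h₁ ≠ 0 := sub_ne_zero.mpr hlt₁.ne
  have hp₂ : p - h₂ ≠ 0 := sub_ne_zero.mpr hlt₂.ne'
  refine ⟨levelPoint p h₁, levelPoint p h₂, ?_, ?_⟩
  · intro hab
    have hH := pH_levelPoint hp₁ (hs h₁ hQ₁)
    rw [hab, pH_levelPoint hp₂ (hs h₂ hQ₂)] at hH
    linarith
  ext ⟨x, y⟩
  simp only [Set.mem_preimage, Set.mem_singleton_iff, Set.mem_insert_iff]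
  constructor
  · intro hz
    have hzp : pF x y + pH x y = p := congrArg Prod.fst hz
    have hzv : (pinchuk (x, y)).2 = v := congrArg Prod.snd hz
    have hf : pF x y ≠ 0 := by
      intro hf
      rw [pinchuk_snd_of_pF_eq_zero hf] at hzv
      have hH := pH_eq_zero_or_neg_one hf
      rw [hf, zero_add] at hzp
      rw [hzp] at hH
      rcases hpv with h | h
      · exact hH.elim h.1 h.2
      · linarith [sq_nonneg (pT x y)]
    have hQ := pinchuk_snd_eq_levelQ hf
    have hpt := eq_levelPoint hf
    rw [hzp] at hQ hpt
    rw [hzv] at hQ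
    rw [hpt]
    have hne : pH x y ≠ p := fun h => hf (by linear_combination hzp - h)
    rcases hne.lt_or_gt with hlt | hlt
    · right
      rw [(strictAntiOn_levelQ p).injOn hlt hlt₂ (hQ.symm.trans hQ₂.symm)]
    · left
      rw [(strictMonoOn_levelQ p).injOn hlt hlt₁ (hQ.symm.trans hQ₁.symm)]
  · rintro (h | h)
    · rw [h, pinchuk_levelPoint hp₁ (hs h₁ hQ₁), hQ₁]
    · rw [h, pinchuk_levelPoint hp₂ (hs h₂ hQ₂), hQ₂]

/-- If for every `t ≠ 0` there is exactly one zero of `f` on the level `h = p`, negative values of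
the second coordinate are attained twice on the line over `p`. -/
lemma pinchuk_fiber_of_neg {p v : ℝ} (hp : p = 0 ∨ p = -1) (hv : v < 0) {g : ℝ → ℝ × ℝ}
    (hg : ∀ x y t, t ≠ 0 → ((pT x y = t ∧ pH x y = p ∧ pF x y = 0) ↔ (x, y) = g t)) :
    ∃ a b : ℝ × ℝ, a ≠ b ∧ pinchuk ⁻¹' {(p, v)} = {a, b} := by
  obtain ⟨t, ht, rfl⟩ : ∃ t : ℝ, t ≠ 0 ∧ v = -t ^ 2 :=
    ⟨√(-v), (Real.sqrt_pos.mpr (by linarith)).ne', by rw [Real.sq_sqrt (by linarith), neg_neg]⟩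
  have ht' : -t ≠ 0 := neg_ne_zero.mpr ht
  refine ⟨g t, g (-t), ?_, ?_⟩
  · intro hab
    have h1 := ((hg (g t).1 (g t).2 t ht).mpr rfl).1
    have h2 := ((hg (g t).1 (g t).2 (-t) ht').mpr hab).1
    exact ht (by linarith)
  ext ⟨x, y⟩
  simp only [Set.mem_preimage, Set.mem_singleton_iff, Set.mem_insert_iff]
  constructor
  · intro hz
    have hzp : pF x y + pH x y = p := congrArg Prod.fst hz
    have hzv : (pinchuk (x, y)).2 = -t ^ 2 := congrArg Prod.snd hz
    have hf : pF x y = 0 := by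
      by_contra hf
      rw [pinchuk_snd_eq_levelQ hf, hzp] at hzv
      have := levelQ_pos (h := pH x y) hp (fun h => hf (by linear_combination hzp + h))
      linarith
    rw [pinchuk_snd_of_pF_eq_zero hf, neg_inj, sq_eq_sq_iff_eq_or_eq_neg] at hzv
    rw [hf, zero_add] at hzp
    exact hzv.imp (fun h => (hg x y t ht).mp ⟨h, hzp, hf⟩)
      (fun h => (hg x y (-t) ht').mp ⟨h, hzp, hf⟩)
  · have key : ∀ s, s ≠ 0 → (x, y) = g s → pinchuk (x, y) = (p, -s ^ 2) := by
      intro s hs h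
      obtain ⟨h1, h2, h3⟩ := (hg x y s hs).mpr h
      refine Prod.ext ?_ ?_
      · simp [pinchuk, h2, h3]
      · rw [pinchuk_snd_of_pF_eq_zero h3, h1]
    rintro (h | h)
    · exact key t ht h
    · rw [key (-t) ht' h, neg_sq]

lemma pH_eq_zero_and_pF_eq_zero_iff (x y t : ℝ) (ht : t ≠ 0) :
    (pT x y = t ∧ pH x y = 0 ∧ pF x y = 0) ↔ (x, y) = (-1 / t, -t * (t + 1)) := by
  rw [Prod.mk.injEq]
  constructor
  · rintro ⟨h1, h2, -⟩
    rw [pH, h1] at h2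
    rw [pT] at h1
    have hx : x * t + 1 = 0 := (mul_eq_zero.mp h2).resolve_left ht
    exact ⟨by rw [eq_div_iff ht]; linear_combination hx, by linear_combination y * hx - t * h1⟩
  · rintro ⟨rfl, rfl⟩
    have h1 : pT (-1 / t) (-t * (t + 1)) = t := by rw [pT]; field_simp; ring
    have h2 : -1 / t * t + 1 = 0 := by field_simp; ring
    exact ⟨h1, by rw [pH, h1, h2, mul_zero], by rw [pF, h1, h2]; ring⟩

lemma pH_eq_neg_one_and_pF_eq_zero_iff (x y t : ℝ) (ht : t ≠ 0) :
    (pT x y = t ∧ pH x y = -1 ∧ pF x y = 0) ↔ (x, y) = (-(t + 1) / t ^ 2, -t ^ 2) := by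
  rw [Prod.mk.injEq]
  constructor
  · rintro ⟨h1, h2, h3⟩
    rw [pH, h1] at h2
    rw [pF, h1] at h3
    have hx : x * t + 1 ≠ 0 := by
      intro h
      rw [h] at h2
      norm_num at h2
    have hy := (mul_eq_zero.mp h3).resolve_left (pow_ne_zero 2 hx)
    exact ⟨by rw [eq_div_iff (pow_ne_zero 2 ht)]; linear_combination h2,
      by linear_combination hy⟩
  · rintro ⟨rfl, rfl⟩
    have h1 : pT (-(t + 1) / t ^ 2) (-t ^ 2) = t := by rw [pT]; field_simp; ring
    exact ⟨h1, by rw [pH, h1]; field_simp; ring, by rw [pF, h1]; ring⟩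

/-- For every `v ∈ ℝ² \ C`, the fiber `F⁻¹(v)` of Pinchuk's map has exactly
    two elements. -/
theorem pinchuk_fiber_two_off_curve :
    ∀ v : ℝ × ℝ, v ∉ Set.range Phi →
      ∃ a b : ℝ × ℝ, a ≠ b ∧ pinchuk ⁻¹' {v} = {a, b} := by
  rintro ⟨p, v⟩ hC
  by_cases hpv : (p ≠ 0 ∧ p ≠ -1) ∨ 0 < v
  · exact pinchuk_fiber_generic hC hpv
  rw [not_or, not_and_or, not_not, not_not, not_lt] at hpv
  obtain ⟨hp, hv⟩ := hpv
  have hv0 : v ≠ 0 := by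
    rintro rfl
    exact hC ⟨p, by rcases hp with rfl | rfl <;> norm_num [Phi, pU]⟩
  have hneg : v < 0 := lt_of_le_of_ne hv hv0
  rcases hp with rfl | rfl
  · exact pinchuk_fiber_of_neg (Or.inl rfl) hneg pH_eq_zero_and_pF_eq_zero_iff
  · exact pinchuk_fiber_of_neg (Or.inr rfl) hneg pH_eq_neg_one_and_pF_eq_zero_iff
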